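/- Let n be a positive integer and let G = D_n be the dihedral group of order 2n. Then H^2(G, ℚ/ℤ) (with ℚ/ℤ as a trivial G-module) is isomorphic to H^1(ℤ/2ℤ, ℤ/nℤ), where the nontrivial element of ℤ/2ℤ acts on ℤ/nℤ by x ↦ −x. -/

import Mathlib

noncomputable section

/-- The abelian group `ℚ/ℤ`, as the quotient of `ℚ` by the (image of) `ℤ`,
regarded as `ℤ`-modules. -/
abbrev RatModInt : Type := ℚ ⧸ Submodule.span ℤ ({1} : Set ℚ)

/-- The representation of `ℤ/2ℤ` (written multiplicatively) on `ℤ/nℤ` in which the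
nontrivial element acts by negation `x ↦ -x`. -/
def negRep (n : ℕ) : Representation ℤ (Multiplicative (ZMod 2)) (ZMod n) where
  toFun g := if Multiplicative.toAdd g = 0 then LinearMap.id else -LinearMap.id
  map_one' := by
    simp only [toAdd_one, if_pos rfl]
    rfl
  map_mul' x y := by
    have h : ∀ a : ZMod 2, a = 0 ∨ a = 1 := by decide
    have hxy : Multiplicative.toAdd (x * y) =
        Multiplicative.toAdd x + Multiplicative.toAdd y := rfl
    rcases h (Multiplicative.toAdd x) with hx | hx <;>
      rcases h (Multiplicative.toAdd y) with hy | hy <;>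
        simp [hxy, hx, hy] <;> exact LinearMap.ext fun z => rfl

end

section CocycleExtension

/-- The underlying set of the extension of `G` by `A` classified by a 2-cocycle `f`. -/
@[ext]
structure CocycleExtension {G A : Type*} (f : G × G → A) where
  /-- The component in the kernel. -/
  fiber : A
  /-- The component in the quotient. -/
  base : G

namespace CocycleExtension

variable {G A : Type*} [Group G] [AddCommGroup A] {f : G × G → A}

/-- The group structure on the extension classified by a 2-cocycle for the trivial action. -/
abbrev group (hf : ∀ g h j, f (g * h, j) + f (g, h) = f (h, j) + f (g, h * j)) :
    Group (CocycleExtension f) :=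
  have hone (g : G) : f (1, g) = f (1, 1) := by
    have := hf 1 1 g
    simp only [one_mul] at this
    exact (add_left_cancel this).symm
  letI : Mul (CocycleExtension f) :=
    ⟨fun x y => ⟨x.fiber + y.fiber + f (x.base, y.base), x.base * y.base⟩⟩
  letI : One (CocycleExtension f) := ⟨⟨-f (1, 1), 1⟩⟩
  letI : Inv (CocycleExtension f) :=
    ⟨fun x => ⟨-x.fiber - f (x.base⁻¹, x.base) - f (1, 1), x.base⁻¹⟩⟩
  Group.ofLeftAxioms
    (fun x y t => CocycleExtension.ext (by
      change x.fiber + y.fiber + f (x.base, y.base) + t.fiber + f (x.base * y.base, t.base) =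
        x.fiber + (y.fiber + t.fiber + f (y.base, t.base)) + f (x.base, y.base * t.base)
      linear_combination (norm := abel) hf x.base y.base t.base) (mul_assoc _ _ _))
    (fun x => CocycleExtension.ext (by
      change -f (1, 1) + x.fiber + f (1, x.base) = x.fiber
      rw [hone x.base]
      abel) (one_mul _))
    (fun x => CocycleExtension.ext (by
      change -x.fiber - f (x.base⁻¹, x.base) - f (1, 1) + x.fiber + f (x.base⁻¹, x.base) =
        -f (1, 1)
      abel) (inv_mul_cancel _))

end CocycleExtension

end CocycleExtension

namespace DihedralGroup

variable {n : ℕ} {A : Type*} [AddCommGroup A]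

/-- The 2-cochain on the dihedral group attached to a homomorphism `w : ℤ/n → A`; it classifies
the central extension in which `s² = rⁿ = 1` and `r s = w(1) s r⁻¹`. -/
def twistCochain (w : ZMod n →+ A) : DihedralGroup n × DihedralGroup n → A
  | (r i, sr _) => w i
  | (sr i, sr _) => w i
  | (r _, r _) => 0
  | (sr _, r _) => 0

lemma twistCochain_cocycle (w : ZMod n →+ A) (g h j : DihedralGroup n) :
    twistCochain w (g * h, j) + twistCochain w (g, h) =
      twistCochain w (h, j) + twistCochain w (g, h * j) := by
  rcases g with a | a <;> rcases h with b | b <;> rcases j with c | c <;>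
    simp [twistCochain] <;> abel

lemma twistCochain_add (v w : ZMod n →+ A) :
    twistCochain (v + w) = twistCochain v + twistCochain w := by
  funext ⟨g, h⟩
  rcases g with a | a <;> rcases h with b | b <;> simp [twistCochain]

lemma exists_eq_add_self_of_twistCochain_eq {w : ZMod n →+ A} {x : DihedralGroup n → A}
    (hx : ∀ g h, twistCochain w (g, h) = x h - x (g * h) + x g) :
    ∃ v : ZMod n →+ A, w = v + v := by
  have hrr (i j : ZMod n) : x (r (i + j)) = x (r i) + x (r j) := by
    have := hx (r i) (r j)
    simp only [twistCochain, r_mul_r] at this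
    linear_combination (norm := abel) this
  refine ⟨AddMonoidHom.mk' (fun i => x (r i)) hrr, ?_⟩
  ext i
  have h1 := hx (r i) (sr 0)
  have h2 := hx (sr 0) (r (-i))
  have h3 := hrr i (-i)
  have h4 := hrr 0 0
  simp only [twistCochain, r_mul_sr, sr_mul_r, zero_sub, zero_add, add_neg_cancel] at h1 h2 h3 h4
  simp only [AddMonoidHom.add_apply, AddMonoidHom.mk'_apply]
  linear_combination (norm := abel) h1 - h2 + h3 + h4

lemma twistCochain_add_self (v : ZMod n →+ A) : ∃ x : DihedralGroup n → A,
    ∀ g h, twistCochain (v + v) (g, h) = x h - x (g * h) + x g := by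
  refine ⟨fun g => match g with | r i => v i | sr i => v i, fun g h => ?_⟩
  rcases g with a | a <;> rcases h with b | b <;> simp [twistCochain]

/-- A central extension of the dihedral group by a group divisible by `n` and `2` has a section
whose associated 2-cocycle is a `twistCochain`. -/
lemma exists_section_mul_eq {E : Type*} [Group E] (p : E →* DihedralGroup n)
    (z : Multiplicative A →* E) (hp : Function.Surjective p) (hinj : Function.Injective z)
    (hcomm : ∀ a e, Commute (z a) e) (hker : ∀ e, p e = 1 → ∃ a, z a = e)
    (hpz : ∀ a, p (z a) = 1)
    (hn : ∀ a : A, ∃ b, n • b = a) (htwo : ∀ a : A, ∃ b, 2 • b = a) :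
    ∃ (w : ZMod n →+ A) (σ : DihedralGroup n → E), (∀ g, p (σ g) = g) ∧
      ∀ g h, σ g * σ h = z (.ofAdd (twistCochain w (g, h))) * σ (g * h) := by
  have lift (g : DihedralGroup n) (m : ℕ) (hm : ∀ a : A, ∃ b, m • b = a) (hg : g ^ m = 1) :
      ∃ e, p e = g ∧ e ^ m = 1 := by
    obtain ⟨e, rfl⟩ := hp g
    obtain ⟨a, ha⟩ := hker (e ^ m) (by simpa using hg)
    obtain ⟨b, hb⟩ := hm a.toAdd
    refine ⟨z (.ofAdd b)⁻¹ * e, by rw [map_mul, hpz, one_mul], ?_⟩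
    rw [(hcomm _ _).mul_pow, ← map_pow, ← ha, inv_pow, ← ofAdd_nsmul, hb, ← map_mul]
    simp
  obtain ⟨R, hR, hRn⟩ := lift (r 1) n hn r_one_pow_n
  obtain ⟨S, hS, hS2⟩ := lift (sr 0) 2 htwo (by rw [pow_two, sr_mul_self])
  rw [pow_two] at hS2
  obtain ⟨ρ, hρ, hpρ⟩ : ∃ ρ : ZMod n → E, (∀ i j, ρ (i + j) = ρ i * ρ j) ∧
      ∀ i, p (ρ i) = r i := by
    let φ : ZMod n →+ Additive E := ZMod.lift n ⟨zmultiplesHom (Additive E) (.ofMul R), by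
      simp [← ofMul_pow, hRn]⟩
    refine ⟨fun i => (φ i).toMul, fun i j => by simp, fun i => ?_⟩
    obtain ⟨k, rfl⟩ := ZMod.intCast_surjective i
    simp [φ, ← ofMul_zpow, hR]
  have hw (i : ZMod n) : ∃ a : Multiplicative A, ρ i * S = z a * (S * ρ (-i)) := by
    obtain ⟨a, ha⟩ := hker (ρ i * S * (S * ρ (-i))⁻¹) (by simp [hpρ, hS])
    exact ⟨a, by rw [ha, inv_mul_cancel_right]⟩
  choose w hw using hw
  have hwadd (i j : ZMod n) : w (i + j) = w i * w j := by
    apply hinj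
    apply mul_right_cancel (b := S * ρ (-(i + j)))
    rw [← hw, hρ, mul_assoc, hw j, map_mul, ← mul_assoc (ρ i), ← (hcomm _ _).eq,
      mul_assoc (z (w j)), ← mul_assoc (ρ i), hw i, ← (hcomm _ _).eq, neg_add, hρ]
    simp only [mul_assoc]
  refine ⟨AddMonoidHom.mk' (fun i => (w i).toAdd) fun i j => by simp [hwadd],
    fun g => match g with | r i => ρ i | sr i => S * ρ i, ?_, ?_⟩
  · rintro (i | i) <;> simp [hpρ, hS]
  · rintro (i | i) (j | j)
    · simp [twistCochain, hρ]
    · simp only [twistCochain, r_mul_sr, AddMonoidHom.mk'_apply, ofAdd_toAdd]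
      rw [← mul_assoc, hw, sub_eq_neg_add, hρ]
      simp only [mul_assoc]
    · simp [twistCochain, hρ, mul_assoc]
    · simp only [twistCochain, sr_mul_sr, AddMonoidHom.mk'_apply, ofAdd_toAdd]
      rw [← mul_assoc, mul_assoc S, hw, ← mul_assoc S, ← (hcomm _ _).eq, sub_eq_neg_add, hρ,
        mul_assoc (z _), ← mul_assoc S S, hS2, one_mul, mul_assoc]

lemma exists_eq_twistCochain_add {f : DihedralGroup n × DihedralGroup n → A}
    (hf : ∀ g h j, f (g * h, j) + f (g, h) = f (h, j) + f (g, h * j))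
    (hn : ∀ a : A, ∃ b, n • b = a) (htwo : ∀ a : A, ∃ b, 2 • b = a) :
    ∃ (w : ZMod n →+ A) (x : DihedralGroup n → A),
      ∀ g h, twistCochain w (g, h) - f (g, h) = x h - x (g * h) + x g := by
  let := CocycleExtension.group hf
  have hone_left (g : DihedralGroup n) : f (1, g) = f (1, 1) := by
    have := hf 1 1 g
    simp only [one_mul] at this
    exact (add_left_cancel this).symm
  have hone_right (g : DihedralGroup n) : f (g, 1) = f (1, 1) := by
    have := hf g 1 1
    simp only [mul_one] at this
    exact add_right_cancel this
  have mul_def (x y : CocycleExtension f) :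
      x * y = ⟨x.fiber + y.fiber + f (x.base, y.base), x.base * y.base⟩ := rfl
  let p : CocycleExtension f →* DihedralGroup n := MonoidHom.mk' CocycleExtension.base
    fun _ _ => rfl
  let z : Multiplicative A →* CocycleExtension f :=
    MonoidHom.mk' (fun a => ⟨a.toAdd - f (1, 1), 1⟩) fun a b => by
      rw [mul_def]
      ext
      · simp only [toAdd_mul]; abel
      · simp
  have hz (a : A) (e : CocycleExtension f) : z (.ofAdd a) * e = ⟨a + e.fiber, e.base⟩ := by
    rw [mul_def]
    ext
    · simp only [z, MonoidHom.mk'_apply, toAdd_ofAdd, hone_left]; abel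
    · simp [z]
  obtain ⟨w, σ, hσ, hmul⟩ := exists_section_mul_eq p z (fun g => ⟨⟨0, g⟩, rfl⟩)
    (fun a b hab => by
      have := congrArg CocycleExtension.fiber hab
      simpa [z] using this)
    (fun a e => by
      change z (.ofAdd a.toAdd) * e = e * z a
      rw [hz, mul_def]
      ext
      · simp only [z, MonoidHom.mk'_apply, hone_right]; abel
      · simp [z])
    (fun e he => ⟨.ofAdd (e.fiber + f (1, 1)), by
      ext
      · simp [z]
      · exact he.symm⟩)
    (fun a => rfl) hn htwo
  refine ⟨w, fun g => (σ g).fiber, fun g h => ?_⟩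
  have := congrArg CocycleExtension.fiber (hmul g h)
  rw [hz, mul_def] at this
  have hb (g : DihedralGroup n) : (σ g).base = g := hσ g
  simp only [hb] at this
  linear_combination (norm := abel) -this

open groupCohomology in
/-- For `A` divisible by `n` and `2`, `H²(Dₙ, A)` is the quotient of `Hom(ℤ/n, A)` by its
doubles. -/
lemma exists_surjective_addMonoidHom_H2 {n : ℕ} {A : Type} [AddCommGroup A]
    (hn : ∀ a : A, ∃ b, n • b = a) (htwo : ∀ a : A, ∃ b, 2 • b = a) :
    ∃ φ : (ZMod n →+ A) →+ groupCohomology (Rep.trivial ℤ (DihedralGroup n) A) 2,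
      Function.Surjective φ ∧ ∀ w, φ w = 0 ↔ ∃ v, w = v + v := by
  let B := Rep.trivial ℤ (DihedralGroup n) A
  let c : (ZMod n →+ A) →+ cocycles₂ B := AddMonoidHom.mk'
    (fun w => ⟨twistCochain w, (mem_cocycles₂_iff (A := B) _).2 (twistCochain_cocycle w)⟩)
    fun v w => Subtype.ext (twistCochain_add v w)
  refine ⟨(H2π B).hom.toAddMonoidHom.comp c, fun y => ?_, fun w => ?_⟩
  · induction y using H2_induction_on with
    | h f =>
      obtain ⟨w, x, hx⟩ := exists_eq_twistCochain_add ((mem_cocycles₂_iff (A := B) _).1 f.2) hn htwo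
      refine ⟨w, (H2π_eq_iff _ _).2 ⟨x, ?_⟩⟩
      funext ⟨g, h⟩
      exact (hx g h).symm
  · refine (H2π_eq_zero_iff (c w)).trans ⟨?_, ?_⟩
    · rintro ⟨x, hx⟩
      exact exists_eq_add_self_of_twistCochain_eq (x := x) fun g h => (congrFun hx (g, h)).symm
    · rintro ⟨v, rfl⟩
      obtain ⟨x, hx⟩ := twistCochain_add_self v
      refine ⟨x, ?_⟩
      funext ⟨g, h⟩
      exact (hx g h).symm

end DihedralGroup

open groupCohomology in
/-- `H¹(ℤ/2, ℤ/n)` for the negation action is the quotient of `ℤ/n` by its doubles. -/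
lemma exists_surjective_addMonoidHom_H1_negRep (n : ℕ) :
    ∃ ψ : ZMod n →+ groupCohomology (Rep.of (negRep n)) 1,
      Function.Surjective ψ ∧ ∀ a, ψ a = 0 ↔ ∃ b, a = b + b := by
  let B := Rep.of (negRep n)
  have h0 (a : ZMod n) : negRep n 1 a = a := by simp
  have h1 (a : ZMod n) : negRep n (.ofAdd 1) a = -a := by simp [negRep]
  have hcases (g : Multiplicative (ZMod 2)) : g = 1 ∨ g = .ofAdd 1 := by
    revert g; decide
  let d (a : ZMod n) (g : Multiplicative (ZMod 2)) : ZMod n := if g = 1 then 0 else a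
  have hd0 (a : ZMod n) : d a 1 = 0 := if_pos rfl
  have hd1 (a : ZMod n) : d a (.ofAdd 1) = a := if_neg (by decide)
  have hsq : (Multiplicative.ofAdd (1 : ZMod 2)) * .ofAdd 1 = 1 := by decide
  have hd (a : ZMod n) : d a ∈ cocycles₁ B := by
    refine (mem_cocycles₁_iff (A := B) _).2 fun g h => ?_
    change d a (g * h) = negRep n g (d a h) + d a g
    rcases hcases g with rfl | rfl <;> rcases hcases h with rfl | rfl <;>
      simp only [one_mul, mul_one, hsq, hd0, hd1, h0, h1] <;> simp
  let c : ZMod n →+ cocycles₁ B := AddMonoidHom.mk' (fun a => ⟨d a, hd a⟩) fun a b => by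
    refine Subtype.ext (funext fun g => ?_)
    change d (a + b) g = d a g + d b g
    rcases hcases g with rfl | rfl <;> simp only [hd0, hd1, add_zero]
  refine ⟨(H1π B).hom.toAddMonoidHom.comp c, fun y => ?_, fun a => ?_⟩
  · induction y using H1_induction_on with
    | h f =>
      refine ⟨f (.ofAdd 1), congrArg (H1π B) (Subtype.ext (funext fun g => ?_))⟩
      change d (f (.ofAdd 1)) g = f g
      rcases hcases g with rfl | rfl
      · rw [hd0]; exact (cocycles₁_map_one f).symm
      · exact hd1 _
  · refine (H1π_eq_zero_iff (c a)).trans ⟨?_, ?_⟩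
    · rintro ⟨b, hb⟩
      have : negRep n (.ofAdd 1) b - b = d a (.ofAdd 1) := congrFun hb _
      rw [h1, hd1] at this
      exact ⟨-(show ZMod n from b), by rw [← this]; exact sub_eq_add_neg _ _⟩
    · rintro ⟨b, rfl⟩
      refine ⟨(-b : ZMod n), funext fun g => ?_⟩
      change negRep n g (-b) - -b = d (b + b) g
      rcases hcases g with rfl | rfl
      · rw [h0, hd0, sub_self]
      · rw [h1, hd1]; ring

lemma RatModInt.exists_nsmul_eq {m : ℕ} (hm : 0 < m) (a : RatModInt) : ∃ b, m • b = a := by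
  obtain ⟨q, rfl⟩ := Submodule.Quotient.mk_surjective _ a
  refine ⟨Submodule.Quotient.mk (q / m), ?_⟩
  rw [← Submodule.Quotient.mk_smul, nsmul_eq_mul, mul_div_cancel₀ _ (by positivity)]

lemma RatModInt.mk_eq_zero_iff (q : ℚ) :
    (Submodule.Quotient.mk q : RatModInt) = 0 ↔ ∃ k : ℤ, (k : ℚ) = q := by
  simp [Submodule.Quotient.mk_eq_zero, Submodule.mem_span_singleton]

/-- The group `ℤ/n` is isomorphic to its Pontryagin dual. -/
lemma nonempty_zmod_addEquiv_hom_ratModInt {n : ℕ} (hn : 0 < n) :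
    Nonempty (ZMod n ≃+ (ZMod n →+ RatModInt)) := by
  have hn0 : (n : ℚ) ≠ 0 := by positivity
  let ι : ZMod n →+ RatModInt :=
    ZMod.lift n ⟨zmultiplesHom RatModInt (Submodule.Quotient.mk (1 / (n : ℚ))), by
      rw [zmultiplesHom_apply, ← Submodule.Quotient.mk_smul, RatModInt.mk_eq_zero_iff]
      exact ⟨1, by simp [hn0]⟩⟩
  have hι (k : ℤ) : ι k = Submodule.Quotient.mk ((k : ℚ) / n) := by
    simp only [ι, ZMod.lift_coe, zmultiplesHom_apply, ← Submodule.Quotient.mk_smul]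
    simp [div_eq_mul_inv]
  let e : ZMod n →+ (ZMod n →+ RatModInt) := AddMonoidHom.mk'
    (fun c => ι.comp (AddMonoidHom.mulRight c)) fun a b => by
      ext i
      simp [mul_add]
  have he (c i : ZMod n) : e c i = ι (i * c) := rfl
  refine ⟨AddEquiv.ofBijective e ⟨(injective_iff_map_eq_zero e).2 fun c hc => ?_, fun w => ?_⟩⟩
  · have h := DFunLike.congr_fun hc 1
    obtain ⟨k, rfl⟩ := ZMod.intCast_surjective c
    rw [he, one_mul, hι, AddMonoidHom.zero_apply, RatModInt.mk_eq_zero_iff] at h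
    obtain ⟨m, hm⟩ := h
    rw [eq_div_iff hn0] at hm
    rw [ZMod.intCast_zmod_eq_zero_iff_dvd]
    exact ⟨m, by rw [mul_comm]; exact_mod_cast hm.symm⟩
  · obtain ⟨q, hq⟩ := Submodule.Quotient.mk_surjective _ (w 1)
    have h : n • w 1 = 0 := by rw [← map_nsmul]; simp
    rw [← hq, ← Submodule.Quotient.mk_smul, RatModInt.mk_eq_zero_iff] at h
    obtain ⟨k, hk⟩ := h
    refine ⟨k, AddMonoidHom.ext fun i => ?_⟩
    obtain ⟨j, rfl⟩ := ZMod.intCast_surjective i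
    have hw : w (j : ZMod n) = j • w 1 := by rw [← map_zsmul]; simp
    rw [he, ← Int.cast_mul, hι, hw, ← hq, ← Submodule.Quotient.mk_smul]
    congr 1
    rw [Int.cast_mul, hk, nsmul_eq_mul, zsmul_eq_mul]
    field_simp

/-- For `n` a positive integer and `G = Dₙ` the dihedral group of order `2n`,
`H²(G, ℚ/ℤ)` (with `ℚ/ℤ` a trivial `G`-module) is isomorphic to `H¹(ℤ/2ℤ, ℤ/nℤ)`, where the
nontrivial element of `ℤ/2ℤ` acts on `ℤ/nℤ` by `x ↦ -x`. -/
theorem dihedral_H2_QmodZ_iso_H1_neg_action (n : ℕ) (hn : 0 < n) :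
    Nonempty ((groupCohomology (Rep.trivial ℤ (DihedralGroup n) RatModInt) 2) ≃+
      groupCohomology (Rep.of (negRep n)) 1) := by
  obtain ⟨φ, hφ, hφ0⟩ := DihedralGroup.exists_surjective_addMonoidHom_H2 (n := n) (A := RatModInt)
    (RatModInt.exists_nsmul_eq hn) (RatModInt.exists_nsmul_eq two_pos)
  obtain ⟨ψ, hψ, hψ0⟩ := exists_surjective_addMonoidHom_H1_negRep n
  obtain ⟨e⟩ := nonempty_zmod_addEquiv_hom_ratModInt hn
  have hker : (φ.comp e.toAddMonoidHom).ker = ψ.ker := by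
    ext a
    simp only [AddMonoidHom.mem_ker, hψ0]
    refine (hφ0 (e a)).trans ⟨fun ⟨v, hv⟩ => ⟨e.symm v, e.injective ?_⟩, fun ⟨b, hb⟩ => ⟨e b, ?_⟩⟩
    · rw [hv, map_add, e.apply_symm_apply]
    · rw [hb, map_add]
  exact ⟨(QuotientAddGroup.quotientKerEquivOfSurjective (φ.comp e.toAddMonoidHom)
      (hφ.comp e.surjective)).symm.trans
    ((QuotientAddGroup.quotientAddEquivOfEq hker).trans
      (QuotientAddGroup.quotientKerEquivOfSurjective ψ hψ))⟩
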